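/- Let L be a tabular quasi-normal modal logic. There exist polynomials p and q (depending only on L) such that: for every monotone function f : ℕ → ℕ, if every propositional formula χ has, for every signature σ' ⊆ sig(χ), a uniform σ'-interpolant of dag-size at most f(|χ|), then every modal formula φ and every σ ⊆ sig(φ) admit a strongest L(σ)-implicate of φ of dag-size at most p(f(q(|φ|))). -/

import Mathlib

inductive MForm (α : Type) : Type
  | top : MForm α
  | atom : α → MForm α
  | neg : MForm α → MForm α
  | and : MForm α → MForm α → MForm α
  | box : MForm α → MForm α
deriving DecidableEq

namespace MForm

def imp {α : Type} (φ ψ : MForm α) : MForm α := neg (and φ (neg ψ))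

def dia {α : Type} (φ : MForm α) : MForm α := neg (box (neg φ))

def sig {α : Type} [DecidableEq α] : MForm α → Finset α
  | top => ∅
  | atom p => {p}
  | neg φ => sig φ
  | and φ ψ => sig φ ∪ sig ψ
  | box φ => sig φ

def IsProp {α : Type} : MForm α → Prop
  | top => True
  | atom _ => True
  | neg φ => IsProp φ
  | and φ ψ => IsProp φ ∧ IsProp ψ
  | box _ => False

def subf {α : Type} [DecidableEq α] : MForm α → Finset (MForm α)
  | top => {top}
  | atom p => {atom p}
  | neg φ => insert (neg φ) (subf φ)
  | and φ ψ => insert (and φ ψ) (subf φ ∪ subf ψ)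
  | box φ => insert (box φ) (subf φ)

/-- The dag-size of a formula: the number of its distinct subformulas. -/
def dagSize {α : Type} [DecidableEq α] (φ : MForm α) : ℕ := (subf φ).card

end MForm

def psat {α : Type} (v : α → Prop) : MForm α → Prop
  | .top => True
  | .atom p => v p
  | .neg φ => ¬ psat v φ
  | .and φ ψ => psat v φ ∧ psat v ψ
  | .box _ => True

/-- Propositional tautology. -/
def PTaut {α : Type} (φ : MForm α) : Prop := ∀ v : α → Prop, psat v φ

def bigAnd {α : Type} : List (MForm α) → MForm α
  | [] => .top
  | φ :: l => .and φ (bigAnd l)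

def bigOr {α : Type} (l : List (MForm α)) : MForm α := .neg (bigAnd (l.map .neg))

def boxIter {α : Type} : ℕ → MForm α → MForm α
  | 0, φ => φ
  | n + 1, φ => .box (boxIter n φ)

def diaIter {α : Type} : ℕ → MForm α → MForm α
  | 0, φ => φ
  | n + 1, φ => MForm.dia (diaIter n φ)

/-- `□^{≤n} φ`. -/
def ble {α : Type} (n : ℕ) (φ : MForm α) : MForm α :=
  bigAnd ((List.range (n + 1)).map (fun k => boxIter k φ))

/-- `◇^{≤n} φ`. -/
def dle {α : Type} (n : ℕ) (φ : MForm α) : MForm α := .neg (ble n (.neg φ))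

def substAtoms {α β : Type} (s : α → MForm β) : MForm α → MForm β
  | .top => .top
  | .atom a => s a
  | .neg φ => .neg (substAtoms s φ)
  | .and φ ψ => .and (substAtoms s φ) (substAtoms s ψ)
  | .box φ => .box (substAtoms s φ)


/-- A finite pointed frame. -/
structure PFin where
  W : Type
  fin : Fintype W
  R : W → W → Prop
  pt : W

attribute [instance] PFin.fin

def sat (F : PFin) (V : F.W → ℕ → Prop) : F.W → MForm ℕ → Prop
  | _, .top => True
  | w, .atom p => V w p
  | w, .neg φ => ¬ sat F V w φ
  | w, .and φ ψ => sat F V w φ ∧ sat F V w ψ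
  | w, .box φ => ∀ v, F.R w v → sat F V v φ

/-- The logic determined by a family of finite pointed frames. -/
def Log {ι : Type} (Fr : ι → PFin) : Set (MForm ℕ) :=
  {φ | ∀ i, ∀ V : (Fr i).W → ℕ → Prop, sat (Fr i) V (Fr i).pt φ}

/-- A tabular (quasi-normal) modal logic: the logic of a finite set of finite pointed
frames. -/
def Tabular (L : Set (MForm ℕ)) : Prop :=
  ∃ (ι : Type) (_ : Fintype ι) (Fr : ι → PFin), L = Log Fr

def StrImp (L : Set (MForm ℕ)) (σ : Finset ℕ) (φ χ : MForm ℕ) : Prop :=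
  χ.sig ⊆ σ ∧ φ.imp χ ∈ L ∧
    ∀ ψ : MForm ℕ, ψ.sig ⊆ σ → φ.imp ψ ∈ L → χ.imp ψ ∈ L

def CraigInt (L : Set (MForm ℕ)) (φ ψ χ : MForm ℕ) : Prop :=
  φ.imp χ ∈ L ∧ χ.imp ψ ∈ L ∧ χ.sig ⊆ φ.sig ∩ ψ.sig

def HasCIP (L : Set (MForm ℕ)) : Prop :=
  ∀ φ ψ : MForm ℕ, φ.imp ψ ∈ L → ∃ χ, CraigInt L φ ψ χ

/-- Uniform propositional `σ'`-interpolant. -/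
def UPropInt {β : Type} [DecidableEq β] (σ' : Finset β) (χ ξ : MForm β) : Prop :=
  ξ.IsProp ∧ ξ.sig ⊆ σ' ∧ PTaut (χ.imp ξ) ∧
    ∀ ψ : MForm β, ψ.IsProp → ψ.sig ∩ χ.sig ⊆ σ' → PTaut (χ.imp ψ) → PTaut (ξ.imp ψ)

/-- Propositional Craig interpolant for a tautological implication. -/
def PCraig {β : Type} [DecidableEq β] (χ₁ χ₂ ξ : MForm β) : Prop :=
  ξ.IsProp ∧ ξ.sig ⊆ χ₁.sig ∩ χ₂.sig ∧ PTaut (χ₁.imp ξ) ∧ PTaut (ξ.imp χ₂)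

/-! ### Size lemmas -/

section Size

variable {α β : Type} [DecidableEq α] [DecidableEq β]

theorem ds_neg (φ : MForm α) : (MForm.neg φ).dagSize ≤ φ.dagSize + 1 :=
  Finset.card_insert_le _ _

theorem ds_box (φ : MForm α) : (MForm.box φ).dagSize ≤ φ.dagSize + 1 :=
  Finset.card_insert_le _ _

theorem ds_and (φ ψ : MForm α) : (MForm.and φ ψ).dagSize ≤ φ.dagSize + ψ.dagSize + 1 :=
  (Finset.card_insert_le _ _).trans (Nat.add_le_add_right (Finset.card_union_le _ _) 1)

theorem ds_top : (MForm.top : MForm α).dagSize = 1 := rfl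

theorem ds_atom (a : α) : (MForm.atom a : MForm α).dagSize = 1 := rfl

theorem ds_imp (φ ψ : MForm α) : (φ.imp ψ).dagSize ≤ φ.dagSize + ψ.dagSize + 3 := by
  have h1 := ds_neg (MForm.and φ (MForm.neg ψ))
  have h2 := ds_and φ (MForm.neg ψ)
  have h3 := ds_neg ψ
  unfold MForm.imp
  omega

theorem ds_bigAnd (c : ℕ) (l : List (MForm α)) (h : ∀ φ ∈ l, φ.dagSize ≤ c) :
    (bigAnd l).dagSize ≤ l.length * (c + 1) + 1 := by
  induction l with
  | nil => simp [bigAnd, ds_top]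
  | cons φ l ih =>
    have h1 := ds_and φ (bigAnd l)
    have h2 := ih (fun ψ hψ => h ψ (List.mem_cons_of_mem _ hψ))
    have h3 := h φ List.mem_cons_self
    simp only [bigAnd, List.length_cons]
    have : (l.length + 1) * (c + 1) = l.length * (c + 1) + (c + 1) := by ring
    omega

theorem ds_bigOr (c : ℕ) (l : List (MForm α)) (h : ∀ φ ∈ l, φ.dagSize ≤ c) :
    (bigOr l).dagSize ≤ l.length * (c + 2) + 2 := by
  have h1 := ds_neg (bigAnd (l.map MForm.neg))
  have h2 := ds_bigAnd (c + 1) (l.map MForm.neg) (by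
    intro φ hφ
    obtain ⟨ψ, hψ, rfl⟩ := List.mem_map.1 hφ
    exact (ds_neg ψ).trans (Nat.add_le_add_right (h ψ hψ) 1))
  rw [List.length_map] at h2
  unfold bigOr
  have : l.length * (c + 1 + 1) = l.length * (c + 2) := rfl
  omega

theorem ds_boxIter (k : ℕ) (φ : MForm α) : (boxIter k φ).dagSize ≤ φ.dagSize + k := by
  induction k with
  | zero => simp [boxIter]
  | succ k ih =>
    have := ds_box (boxIter k φ)
    simp only [boxIter]
    omega

theorem ds_ble (n c : ℕ) (φ : MForm α) (h : φ.dagSize ≤ c) :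
    (ble n φ).dagSize ≤ (n + 1) * (c + n + 1) + 1 := by
  have := ds_bigAnd (c + n) ((List.range (n + 1)).map (fun k => boxIter k φ)) (by
    intro ψ hψ
    obtain ⟨k, hk, rfl⟩ := List.mem_map.1 hψ
    have h1 := ds_boxIter k φ
    have h2 := List.mem_range.1 hk
    omega)
  rw [List.length_map, List.length_range] at this
  exact this

theorem ds_dle (n c : ℕ) (φ : MForm α) (h : φ.dagSize + 1 ≤ c) :
    (dle n φ).dagSize ≤ (n + 1) * (c + n + 1) + 2 := by
  have h1 := ds_neg (ble n (MForm.neg φ))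
  have h2 := ds_ble n c (MForm.neg φ) ((ds_neg φ).trans h)
  unfold dle
  omega

theorem self_mem_subf (φ : MForm α) : φ ∈ φ.subf := by
  cases φ <;> simp [MForm.subf]

theorem atom_mem_subf (φ : MForm α) {a : α} (h : a ∈ φ.sig) : MForm.atom a ∈ φ.subf := by
  induction φ with
  | top => simp [MForm.sig] at h
  | atom b => simp [MForm.sig] at h; simp [MForm.subf, h]
  | neg φ ih => exact Finset.mem_insert_of_mem (ih h)
  | box φ ih => exact Finset.mem_insert_of_mem (ih h)
  | and φ ψ ih1 ih2 =>
    rcases Finset.mem_union.1 h with h | h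
    · exact Finset.mem_insert_of_mem (Finset.mem_union_left _ (ih1 h))
    · exact Finset.mem_insert_of_mem (Finset.mem_union_right _ (ih2 h))

theorem card_sig_le (φ : MForm α) : φ.sig.card ≤ φ.dagSize := by
  unfold MForm.dagSize
  refine Finset.card_le_card_of_injOn MForm.atom (fun a ha => atom_mem_subf φ ha) ?_
  intro a _ b _ h
  exact MForm.atom.inj h

theorem subf_subst (s : α → MForm β) (θ : MForm α) :
    (substAtoms s θ).subf ⊆ θ.subf.image (substAtoms s) ∪ θ.sig.biUnion (fun a => (s a).subf) := by
  induction θ with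
  | top => intro x hx; simp [substAtoms, MForm.subf] at hx ⊢; simp [hx]
  | atom a => intro x hx; simp [substAtoms, MForm.subf, MForm.sig] at hx ⊢; simp [hx]
  | neg φ ih =>
    intro x hx
    simp only [substAtoms, MForm.subf, Finset.mem_insert] at hx
    rcases hx with rfl | hx
    · exact Finset.mem_union_left _ (Finset.mem_image.2 ⟨_, self_mem_subf (MForm.neg φ), rfl⟩)
    · have := ih hx
      simp only [MForm.subf, MForm.sig, Finset.mem_union, Finset.mem_image,
        Finset.mem_insert] at this ⊢
      grind
  | box φ ih =>
    intro x hx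
    simp only [substAtoms, MForm.subf, Finset.mem_insert] at hx
    rcases hx with rfl | hx
    · exact Finset.mem_union_left _ (Finset.mem_image.2 ⟨_, self_mem_subf (MForm.box φ), rfl⟩)
    · have := ih hx
      simp only [MForm.subf, MForm.sig, Finset.mem_union, Finset.mem_image,
        Finset.mem_insert] at this ⊢
      grind
  | and φ ψ ih1 ih2 =>
    intro x hx
    simp only [substAtoms, MForm.subf, Finset.mem_insert, Finset.mem_union] at hx
    rcases hx with rfl | hx | hx
    · exact Finset.mem_union_left _ (Finset.mem_image.2 ⟨_, self_mem_subf (MForm.and φ ψ), rfl⟩)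
    · have := ih1 hx
      simp only [MForm.subf, MForm.sig, Finset.mem_union, Finset.mem_image,
        Finset.mem_insert, Finset.mem_biUnion] at this ⊢
      grind
    · have := ih2 hx
      simp only [MForm.subf, MForm.sig, Finset.mem_union, Finset.mem_image,
        Finset.mem_insert, Finset.mem_biUnion] at this ⊢
      grind

theorem ds_subst (s : α → MForm β) (c : ℕ) (hs : ∀ a, (s a).dagSize ≤ c) (θ : MForm α) :
    (substAtoms s θ).dagSize ≤ θ.dagSize + θ.dagSize * c := by
  refine (Finset.card_le_card (subf_subst s θ)).trans ((Finset.card_union_le _ _).trans ?_)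
  refine Nat.add_le_add Finset.card_image_le ?_
  refine (Finset.card_biUnion_le_card_mul _ _ c (fun a _ => hs a)).trans ?_
  exact Nat.mul_le_mul_right _ (card_sig_le θ)

theorem sig_subst (s : α → MForm β) (σ : Finset β) (θ : MForm α)
    (h : ∀ a ∈ θ.sig, (s a).sig ⊆ σ) : (substAtoms s θ).sig ⊆ σ := by
  induction θ with
  | top => simp [substAtoms, MForm.sig]
  | atom a => exact h a (by simp [MForm.sig])
  | neg φ ih => exact ih h
  | box φ ih => exact ih h
  | and φ ψ ih1 ih2 =>
    exact Finset.union_subset (ih1 (fun a ha => h a (Finset.mem_union_left _ ha)))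
      (ih2 (fun a ha => h a (Finset.mem_union_right _ ha)))

theorem sig_bigAnd (σ : Finset α) (l : List (MForm α)) (h : ∀ φ ∈ l, φ.sig ⊆ σ) :
    (bigAnd l).sig ⊆ σ := by
  induction l with
  | nil => simp [bigAnd, MForm.sig]
  | cons φ l ih =>
    exact Finset.union_subset (h φ List.mem_cons_self)
      (ih (fun ψ hψ => h ψ (List.mem_cons_of_mem _ hψ)))

theorem sig_bigOr (σ : Finset α) (l : List (MForm α)) (h : ∀ φ ∈ l, φ.sig ⊆ σ) :
    (bigOr l).sig ⊆ σ := by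
  refine sig_bigAnd σ (l.map MForm.neg) ?_
  intro φ hφ
  obtain ⟨ψ, hψ, rfl⟩ := List.mem_map.1 hφ
  exact h ψ hψ

theorem sig_boxIter (k : ℕ) (φ : MForm α) : (boxIter k φ).sig = φ.sig := by
  induction k with
  | zero => rfl
  | succ k ih => exact ih

theorem sig_ble (n : ℕ) (σ : Finset α) (φ : MForm α) (h : φ.sig ⊆ σ) : (ble n φ).sig ⊆ σ := by
  refine sig_bigAnd σ _ ?_
  intro ψ hψ
  obtain ⟨k, _, rfl⟩ := List.mem_map.1 hψ
  rw [sig_boxIter]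
  exact h

theorem sig_dle (n : ℕ) (σ : Finset α) (φ : MForm α) (h : φ.sig ⊆ σ) : (dle n φ).sig ⊆ σ :=
  sig_ble n σ (MForm.neg φ) h

/-! ### Propositional semantics -/

theorem psat_bigAnd (v : α → Prop) (l : List (MForm α)) :
    psat v (bigAnd l) ↔ ∀ φ ∈ l, psat v φ := by
  induction l with
  | nil => simp [bigAnd, psat]
  | cons φ l ih => simp [bigAnd, psat, ih]

theorem psat_imp (v : α → Prop) (φ ψ : MForm α) :
    psat v (φ.imp ψ) ↔ (psat v φ → psat v ψ) := by
  simp only [MForm.imp, psat]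
  tauto

theorem psat_congr (v v' : α → Prop) (φ : MForm α) (h : ∀ a ∈ φ.sig, (v a ↔ v' a)) :
    psat v φ ↔ psat v' φ := by
  induction φ with
  | top => rfl
  | atom a => exact h a (by simp [MForm.sig])
  | neg φ ih => exact not_congr (ih h)
  | box φ ih => rfl
  | and φ ψ ih1 ih2 =>
    exact and_congr (ih1 (fun a ha => h a (Finset.mem_union_left _ ha)))
      (ih2 (fun a ha => h a (Finset.mem_union_right _ ha)))

theorem isProp_bigAnd (l : List (MForm α)) (h : ∀ φ ∈ l, φ.IsProp) : (bigAnd l).IsProp := by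
  induction l with
  | nil => trivial
  | cons φ l ih =>
    exact ⟨h φ List.mem_cons_self, ih (fun ψ hψ => h ψ (List.mem_cons_of_mem _ hψ))⟩

open Classical in
theorem interp_iff (P : α → Prop) (χ ξ : MForm α)
    (h : UPropInt (χ.sig.filter P) χ ξ) (v : α → Prop) :
    psat v ξ ↔ ∃ v' : α → Prop, (∀ k, P k → (v' k ↔ v k)) ∧ psat v' χ := by
  obtain ⟨_, hsig, himp, hmin⟩ := h
  constructor
  · intro hv
    by_contra hno
    push Not at hno
    set lit : α → MForm α := fun a => if v a then MForm.atom a else MForm.neg (MForm.atom a)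
      with hlit
    have hlit_sat : ∀ (u : α → Prop) a, psat u (lit a) ↔ (u a ↔ v a) := by
      intro u a
      by_cases hva : v a <;> simp [hlit, hva, psat]
    have hlit_sig : ∀ a, (lit a).sig = {a} := by
      intro a
      by_cases hva : v a <;> simp [hlit, hva, MForm.sig]
    have hlit_prop : ∀ a, (lit a).IsProp := by
      intro a
      by_cases hva : v a <;> simp [hlit, hva, MForm.IsProp]
    set ψ : MForm α := MForm.neg (bigAnd ((χ.sig.filter P).toList.map lit)) with hψ
    have h1 : ψ.sig ⊆ χ.sig.filter P := by
      refine sig_bigAnd _ _ ?_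
      intro φ hφ
      obtain ⟨a, ha, rfl⟩ := List.mem_map.1 hφ
      rw [hlit_sig]
      simpa using ha
    have h2 : ψ.IsProp := by
      refine isProp_bigAnd _ ?_
      intro φ hφ
      obtain ⟨a, ha, rfl⟩ := List.mem_map.1 hφ
      exact hlit_prop a
    have h3 := hmin ψ h2 (fun x hx => h1 (Finset.mem_inter.1 hx).1) (by
      intro u
      rw [psat_imp]
      intro hu hall
      rw [psat_bigAnd] at hall
      have hag : ∀ a ∈ χ.sig, P a → (u a ↔ v a) := by
        intro a ha hPa
        rw [← hlit_sat]
        exact hall _ (List.mem_map.2 ⟨a, by simp [ha, hPa], rfl⟩)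
      refine hno (fun a => if a ∈ χ.sig then u a else v a) ?_ ?_
      · intro k hk
        by_cases hkc : k ∈ χ.sig
        · simpa [hkc] using hag k hkc hk
        · simp [hkc]
      · refine (psat_congr u _ χ ?_).1 hu
        intro a ha
        simp [ha])
    have h4 := (psat_imp v ξ ψ).1 (h3 v) hv
    apply h4
    rw [psat_bigAnd]
    intro φ hφ
    obtain ⟨a, ha, rfl⟩ := List.mem_map.1 hφ
    rw [hlit_sat]
  · rintro ⟨v', hag, hχ⟩
    have h1 := (psat_imp v' χ ξ).1 (himp v') hχ
    refine (psat_congr v' v ξ ?_).1 h1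
    intro a ha
    exact hag a (Finset.mem_filter.1 (hsig ha)).2

theorem mem_sig_of_depends (ξ : MForm α) (a : α) (v v' : α → Prop)
    (hv : ∀ b, b ≠ a → (v b ↔ v' b)) (h1 : psat v ξ) (h2 : ¬ psat v' ξ) : a ∈ ξ.sig := by
  by_contra ha
  refine h2 ((psat_congr v v' ξ ?_).1 h1)
  intro b hb
  exact hv b (fun h => ha (h ▸ hb))

end Size

theorem sig_bigAnd_atoms (l : List ℕ) : (bigAnd (l.map MForm.atom)).sig = l.toFinset := by
  induction l with
  | nil => rfl
  | cons a l ih => simp [bigAnd, MForm.sig, ih]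

theorem f_lower (f : ℕ → ℕ) (hf : Monotone f)
    (h : ∀ χ : MForm ℕ, χ.IsProp → ∀ σ' ⊆ χ.sig,
        ∃ ξ : MForm ℕ, UPropInt σ' χ ξ ∧ ξ.dagSize ≤ f χ.dagSize) (σ : Finset ℕ) :
    σ.card ≤ f (2 * σ.card + 1) := by
  set χ : MForm ℕ := bigAnd (σ.toList.map MForm.atom) with hχ
  have hsig : χ.sig = σ := by rw [hχ, sig_bigAnd_atoms]; simp
  have hprop : χ.IsProp := by
    refine isProp_bigAnd _ ?_
    intro φ hφ
    obtain ⟨a, ha, rfl⟩ := List.mem_map.1 hφ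
    trivial
  have hsat : ∀ v, psat v χ ↔ ∀ a ∈ σ, v a := by
    intro v
    rw [hχ, psat_bigAnd]
    simp [psat]
  obtain ⟨ξ, hξ, hsz⟩ := h χ hprop σ (by rw [hsig])
  have hds : χ.dagSize ≤ 2 * σ.card + 1 := by
    have := ds_bigAnd 1 (σ.toList.map MForm.atom) (by
      intro φ hφ
      obtain ⟨a, ha, rfl⟩ := List.mem_map.1 hφ
      exact le_of_eq (ds_atom a))
    rw [List.length_map, Finset.length_toList] at this
    rw [hχ]
    omega
  have hsub : σ ⊆ ξ.sig := by
    intro a ha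
    obtain ⟨_, _, h1, h2⟩ := hξ
    refine mem_sig_of_depends ξ a (fun _ => True) (fun b => b ≠ a) ?_ ?_ ?_
    · intro b hb; simp [hb]
    · exact (psat_imp _ _ _).1 (h1 _) ((hsat _).2 (by simp))
    · intro hξ'
      have := h2 χ hprop (by rw [hsig]; simp) (by intro v; rw [psat_imp]; exact id)
      have := (hsat _).1 ((psat_imp _ _ _).1 (this _) hξ') a ha
      exact this rfl
  exact (Finset.card_le_card hsub).trans ((card_sig_le ξ).trans (hsz.trans (hf hds)))

/-! ### Modal semantics -/

section Modal

variable (F : PFin)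

theorem sat_bigAnd (V : F.W → ℕ → Prop) (w : F.W) (l : List (MForm ℕ)) :
    sat F V w (bigAnd l) ↔ ∀ φ ∈ l, sat F V w φ := by
  induction l with
  | nil => simp [bigAnd, sat]
  | cons φ l ih => simp [bigAnd, sat, ih]

theorem sat_bigOr (V : F.W → ℕ → Prop) (w : F.W) (l : List (MForm ℕ)) :
    sat F V w (bigOr l) ↔ ∃ φ ∈ l, sat F V w φ := by
  simp [bigOr, sat, sat_bigAnd]

theorem sat_imp (V : F.W → ℕ → Prop) (w : F.W) (φ ψ : MForm ℕ) :
    sat F V w (φ.imp ψ) ↔ (sat F V w φ → sat F V w ψ) := by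
  simp only [MForm.imp, sat]
  tauto

def stepsTo : ℕ → F.W → F.W → Prop
  | 0, w, v => w = v
  | k + 1, w, v => ∃ u, F.R w u ∧ stepsTo k u v

theorem stepsTo_snoc (k : ℕ) (w u v : F.W) (h : stepsTo F k w u) (h' : F.R u v) :
    stepsTo F (k + 1) w v := by
  induction k generalizing w with
  | zero => cases h; exact ⟨v, h', rfl⟩
  | succ k ih =>
    obtain ⟨x, hx, hxu⟩ := h
    exact ⟨x, hx, ih x hxu⟩

def Reach (w : F.W) : Prop := ∃ k, stepsTo F k F.pt w

theorem reach_pt : Reach F F.pt := ⟨0, rfl⟩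

theorem reach_step {u v : F.W} (h : Reach F u) (h' : F.R u v) : Reach F v := by
  obtain ⟨k, hk⟩ := h
  exact ⟨k + 1, stepsTo_snoc F k _ _ _ hk h'⟩

theorem sat_boxIter (V : F.W → ℕ → Prop) (k : ℕ) (w : F.W) (φ : MForm ℕ) :
    sat F V w (boxIter k φ) ↔ ∀ v, stepsTo F k w v → sat F V v φ := by
  induction k generalizing w with
  | zero => simp [boxIter, stepsTo]
  | succ k ih =>
    simp only [boxIter, sat, stepsTo, ih]
    constructor
    · rintro h v ⟨u, hu, huv⟩
      exact h u hu v huv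
    · intro h u hu v huv
      exact h v ⟨u, hu, huv⟩

def Bound (n : ℕ) : Prop := ∀ w, Reach F w → ∃ k ≤ n, stepsTo F k F.pt w

theorem exists_bound : ∃ n, Bound F n := by
  classical
  have : ∀ w : F.W, ∃ k, Reach F w → stepsTo F k F.pt w := by
    intro w
    by_cases h : Reach F w
    · obtain ⟨k, hk⟩ := h
      exact ⟨k, fun _ => hk⟩
    · exact ⟨0, fun h' => absurd h' h⟩
  choose g hg using this
  exact ⟨Finset.univ.sup g, fun w hw => ⟨g w, Finset.le_sup (Finset.mem_univ w), hg w hw⟩⟩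

theorem bound_mono {m n : ℕ} (h : m ≤ n) (hm : Bound F m) : Bound F n := by
  intro w hw
  obtain ⟨k, hk, hs⟩ := hm w hw
  exact ⟨k, hk.trans h, hs⟩

theorem sat_ble {n : ℕ} (hn : Bound F n) (V : F.W → ℕ → Prop) (φ : MForm ℕ) :
    sat F V F.pt (ble n φ) ↔ ∀ v, Reach F v → sat F V v φ := by
  simp only [ble, sat_bigAnd, List.mem_map, List.mem_range]
  constructor
  · intro h v hv
    obtain ⟨k, hk, hs⟩ := hn v hv
    exact (sat_boxIter F V k _ φ).1 (h _ ⟨k, by omega, rfl⟩) v hs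
  · rintro h _ ⟨k, _, rfl⟩
    rw [sat_boxIter]
    intro v hv
    exact h v ⟨k, hv⟩

theorem sat_dle {n : ℕ} (hn : Bound F n) (V : F.W → ℕ → Prop) (φ : MForm ℕ) :
    sat F V F.pt (dle n φ) ↔ ∃ v, Reach F v ∧ sat F V v φ := by
  simp only [dle, sat, sat_ble F hn]
  push Not
  rfl

theorem sat_subst (V : F.W → ℕ → Prop) (s : ℕ → MForm ℕ) (w : F.W) (θ : MForm ℕ) :
    sat F V w (substAtoms s θ) ↔ sat F (fun w k => sat F V w (s k)) w θ := by
  induction θ generalizing w with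
  | top => rfl
  | atom a => rfl
  | neg φ ih => exact not_congr (ih w)
  | box φ ih => exact forall_congr' fun v => imp_congr_right fun _ => ih v
  | and φ ψ ih1 ih2 => exact and_congr (ih1 w) (ih2 w)

theorem sat_subst_prop (V : F.W → ℕ → Prop) (s : ℕ → MForm ℕ) (w : F.W) (θ : MForm ℕ)
    (hθ : θ.IsProp) :
    sat F V w (substAtoms s θ) ↔ psat (fun k => sat F V w (s k)) θ := by
  induction θ with
  | top => rfl
  | atom a => rfl
  | neg φ ih => exact not_congr (ih hθ)
  | box φ ih => exact hθ.elim
  | and φ ψ ih1 ih2 => exact and_congr (ih1 hθ.1) (ih2 hθ.2)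

theorem sat_local (V V' : F.W → ℕ → Prop) (h : ∀ w, Reach F w → ∀ a, V w a ↔ V' w a)
    (φ : MForm ℕ) : ∀ w, Reach F w → (sat F V w φ ↔ sat F V' w φ) := by
  induction φ with
  | top => intro w _; rfl
  | atom a => intro w hw; exact h w hw a
  | neg φ ih => intro w hw; exact not_congr (ih w hw)
  | box φ ih =>
    intro w hw
    exact forall_congr' fun v => imp_congr_right fun hv => ih v (reach_step F hw hv)
  | and φ ψ ih1 ih2 => intro w hw; exact and_congr (ih1 w hw) (ih2 w hw)

theorem sat_congr_sig (V V' : F.W → ℕ → Prop) (φ : MForm ℕ)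
    (h : ∀ w, ∀ a ∈ φ.sig, V w a ↔ V' w a) :
    ∀ w, (sat F V w φ ↔ sat F V' w φ) := by
  induction φ with
  | top => intro w; rfl
  | atom a => intro w; exact h w a (by simp [MForm.sig])
  | neg φ ih => intro w; exact not_congr (ih h w)
  | box φ ih =>
    intro w
    exact forall_congr' fun v => imp_congr_right fun hv => ih h v
  | and φ ψ ih1 ih2 =>
    intro w
    exact and_congr (ih1 (fun w a ha => h w a (Finset.mem_union_left _ ha)) w)
      (ih2 (fun w a ha => h w a (Finset.mem_union_right _ ha)) w)

/-! ### Translation into propositional logic -/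

noncomputable def wcode (w : F.W) : ℕ := (Fintype.equivFin F.W w).val

theorem wcode_inj {w w' : F.W} (h : wcode F w = wcode F w') : w = w' :=
  (Fintype.equivFin F.W).injective (Fin.ext h)

open Classical in
noncomputable def succs (w : F.W) : List F.W := (Finset.univ.filter (fun v => F.R w v)).toList

theorem mem_succs (w v : F.W) : v ∈ succs F w ↔ F.R w v := by
  simp [succs]

theorem length_succs (w : F.W) : (succs F w).length ≤ Fintype.card F.W := by
  classical
  simp only [succs, Finset.length_toList]
  exact Finset.card_le_univ _

noncomputable def ptr : MForm ℕ → F.W → MForm ℕ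
  | .top, _ => .top
  | .atom a, w => .atom (Nat.pair (wcode F w) a)
  | .neg φ, w => .neg (ptr φ w)
  | .and φ ψ, w => .and (ptr φ w) (ptr ψ w)
  | .box φ, w => bigAnd ((succs F w).map (ptr φ))

theorem isProp_trans (φ : MForm ℕ) : ∀ w, (ptr F φ w).IsProp := by
  induction φ with
  | top => intro w; trivial
  | atom a => intro w; trivial
  | neg φ ih => intro w; exact ih w
  | and φ ψ ih1 ih2 => intro w; exact ⟨ih1 w, ih2 w⟩
  | box φ ih =>
    intro w
    refine isProp_bigAnd _ ?_
    intro ψ hψ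
    obtain ⟨v, _, rfl⟩ := List.mem_map.1 hψ
    exact ih v

theorem psat_trans (v : ℕ → Prop) (φ : MForm ℕ) : ∀ w,
    (psat v (ptr F φ w) ↔ sat F (fun w a => v (Nat.pair (wcode F w) a)) w φ) := by
  induction φ with
  | top => intro w; rfl
  | atom a => intro w; rfl
  | neg φ ih => intro w; exact not_congr (ih w)
  | and φ ψ ih1 ih2 => intro w; exact and_congr (ih1 w) (ih2 w)
  | box φ ih =>
    intro w
    simp [ptr, psat_bigAnd, sat, mem_succs, ih]

theorem subf_bigAnd (l : List (MForm ℕ)) :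
    (bigAnd l).subf ⊆ (l.tails.map bigAnd).toFinset ∪ l.toFinset.biUnion MForm.subf := by
  induction l with
  | nil => simp [bigAnd, MForm.subf]
  | cons φ l ih =>
    intro x hx
    simp only [bigAnd, MForm.subf, Finset.mem_insert, Finset.mem_union] at hx
    rcases hx with rfl | hx | hx
    · simp [bigAnd]
    · simp [hx]
    · have := ih hx
      simp only [Finset.mem_union, List.mem_toFinset, List.mem_map, Finset.mem_biUnion,
        List.tails_cons, List.mem_cons] at this ⊢
      grind

noncomputable def pieces (φ : MForm ℕ) (w : F.W) : Finset (MForm ℕ) :=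
  match φ with
  | .box φ => (((succs F w).map (ptr F φ)).tails.map bigAnd).toFinset
  | φ => {ptr F φ w}

theorem card_pieces (φ : MForm ℕ) (w : F.W) :
    (pieces F φ w).card ≤ Fintype.card F.W + 1 := by
  cases φ with
  | box φ =>
    refine (List.toFinset_card_le _).trans ?_
    have := length_succs F w
    simpa using this
  | _ => simp [pieces]

theorem subf_trans (φ : MForm ℕ) : ∀ w,
    (ptr F φ w).subf ⊆ φ.subf.biUnion (fun ψ => Finset.univ.biUnion (pieces F ψ)) := by
  induction φ with
  | top =>
    intro w x hx
    simp [ptr, MForm.subf, pieces] at hx ⊢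
    exact ⟨⟨w⟩, hx⟩
  | atom a =>
    intro w x hx
    simp [ptr, MForm.subf, pieces] at hx ⊢
    exact ⟨w, hx⟩
  | neg φ ih =>
    intro w x hx
    simp only [ptr, MForm.subf, Finset.mem_insert] at hx
    rcases hx with rfl | hx
    · refine Finset.mem_biUnion.2 ⟨_, self_mem_subf _, Finset.mem_biUnion.2 ⟨w, Finset.mem_univ _, ?_⟩⟩
      simp [pieces, ptr]
    · exact Finset.biUnion_subset_biUnion_of_subset_left _ (Finset.subset_insert _ _) (ih w hx)
  | and φ ψ ih1 ih2 =>
    intro w x hx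
    simp only [ptr, MForm.subf, Finset.mem_insert, Finset.mem_union] at hx
    rcases hx with rfl | hx | hx
    · refine Finset.mem_biUnion.2 ⟨_, self_mem_subf _, Finset.mem_biUnion.2 ⟨w, Finset.mem_univ _, ?_⟩⟩
      simp [pieces, ptr]
    · exact Finset.biUnion_subset_biUnion_of_subset_left _
        (Finset.subset_union_left.trans (Finset.subset_insert _ _)) (ih1 w hx)
    · exact Finset.biUnion_subset_biUnion_of_subset_left _
        (Finset.subset_union_right.trans (Finset.subset_insert _ _)) (ih2 w hx)
  | box φ ih =>
    intro w x hx
    rcases Finset.mem_union.1 (subf_bigAnd _ hx) with hx | hx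
    · exact Finset.mem_biUnion.2
        ⟨_, self_mem_subf _, Finset.mem_biUnion.2 ⟨w, Finset.mem_univ _, hx⟩⟩
    · obtain ⟨y, hy, hxy⟩ := Finset.mem_biUnion.1 hx
      obtain ⟨v, _, rfl⟩ := List.mem_map.1 (List.mem_toFinset.1 hy)
      exact Finset.biUnion_subset_biUnion_of_subset_left _ (Finset.subset_insert _ _) (ih v hxy)

theorem ds_trans (φ : MForm ℕ) (w : F.W) :
    (ptr F φ w).dagSize ≤ φ.dagSize * (Fintype.card F.W * (Fintype.card F.W + 1)) := by
  refine (Finset.card_le_card (subf_trans F φ w)).trans ?_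
  refine Finset.card_biUnion_le_card_mul _ _ _ (fun ψ _ => ?_)
  exact Finset.card_biUnion_le_card_mul _ _ _ (fun v _ => card_pieces F ψ v)

end Modal

/-! ### Characteristic formulas -/

def extV {W : Type} {N : ℕ} (U : W → Fin N → Prop) (w : W) (k : ℕ) : Prop :=
  ∃ h : k < N, U w ⟨k, h⟩

abbrev Univ {ι : Type} (Fr : ι → PFin) (N : ℕ) : Type :=
  Σ i, (Fr i).W × ((Fr i).W → Fin N → Prop)

def holds {ι : Type} {Fr : ι → PFin} {N : ℕ} (x : Univ Fr N) (θ : MForm ℕ) : Prop :=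
  sat (Fr x.1) (extV x.2.2) x.2.1 θ

theorem exists_char {ι : Type} [Fintype ι] (Fr : ι → PFin) (N : ℕ) :
    ∃ τ : Univ Fr N → MForm ℕ, ∀ x y : Univ Fr N, holds y (τ x) ↔ ∀ θ, (holds x θ ↔ holds y θ) := by
  classical
  have : ∀ x z : Univ Fr N, ∃ δ, holds x δ ∧
      ((∃ θ, ¬ (holds x θ ↔ holds z θ)) → ¬ holds z δ) := by
    intro x z
    by_cases h : ∃ θ, ¬ (holds x θ ↔ holds z θ)
    · obtain ⟨θ, hθ⟩ := h
      by_cases hx : holds x θ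
      · exact ⟨θ, hx, fun _ => by tauto⟩
      · refine ⟨MForm.neg θ, hx, fun _ hz => ?_⟩
        have : ¬ holds z θ := hz
        tauto
    · exact ⟨MForm.top, trivial, fun h' => absurd h' h⟩
  choose δ hδ1 hδ2 using this
  have : Fintype (Univ Fr N) := Fintype.ofFinite _
  refine ⟨fun x => bigAnd ((Finset.univ : Finset (Univ Fr N)).toList.map (δ x)), ?_⟩
  intro x y
  have key : ∀ z : Univ Fr N, holds z (bigAnd ((Finset.univ : Finset (Univ Fr N)).toList.map (δ x)))
      ↔ ∀ u, holds z (δ x u) := by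
    intro z
    unfold holds
    rw [sat_bigAnd]
    constructor
    · intro h u
      exact h _ (List.mem_map.2 ⟨u, by simp, rfl⟩)
    · intro h φ hφ
      obtain ⟨u, _, rfl⟩ := List.mem_map.1 hφ
      exact h u
  constructor
  · intro h
    by_contra hne
    push Not at hne
    rw [key] at h
    refine hδ2 x y ?_ (h y)
    obtain ⟨θ, hθ⟩ := hne
    exact ⟨θ, by tauto⟩
  · intro h
    rw [← h, key]
    exact hδ1 x

def subA {N : ℕ} {σ : Finset ℕ} (A : Fin N → Option {a // a ∈ σ}) (k : ℕ) : MForm ℕ :=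
  if h : k < N then
    match A ⟨k, h⟩ with
    | some a => .atom a.1
    | none => .top
  else .neg .top

def valA {W : Type} {N : ℕ} {σ : Finset ℕ} (V : W → ℕ → Prop)
    (A : Fin N → Option {a // a ∈ σ}) (w : W) (k : Fin N) : Prop :=
  match A k with
  | some a => V w a.1
  | none => True

theorem ds_subA {N : ℕ} {σ : Finset ℕ} (A : Fin N → Option {a // a ∈ σ}) (k : ℕ) :
    (subA A k).dagSize ≤ 2 := by
  unfold subA
  split
  · split
    · exact (ds_atom _).trans_le (by omega)
    · exact ds_top.trans_le (by omega)
  · exact ds_neg _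

theorem sig_subA {N : ℕ} {σ : Finset ℕ} (A : Fin N → Option {a // a ∈ σ}) (k : ℕ) :
    (subA A k).sig ⊆ σ := by
  unfold subA
  split
  · split
    · next a _ => simpa [MForm.sig] using a.2
    · simp [MForm.sig]
  · simp [MForm.sig]

theorem sat_subA (F : PFin) {N : ℕ} {σ : Finset ℕ} (V : F.W → ℕ → Prop)
    (A : Fin N → Option {a // a ∈ σ}) (w : F.W) (θ : MForm ℕ) :
    sat F V w (substAtoms (subA A) θ) ↔ sat F (extV (valA V A)) w θ := by
  rw [sat_subst]
  have : (fun w k => sat F V w (subA A k)) = extV (valA V A) := by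
    funext w k
    apply propext
    unfold subA extV valA
    by_cases h : k < N
    · simp only [h, dite_true, exists_true_left]
      split <;> simp_all [sat]
    · simp [h, sat]
  rw [this]

/-! ### The strongest implicate -/

section Main

variable {ι : Type} (Fr : ι → PFin) {N : ℕ} (τ : Univ Fr N → MForm ℕ) (n : ℕ) {σ : Finset ℕ}

/-- Characteristic formula of world `w` of the frame `j` with valuation `U`,
read over the atoms selected by `A`. -/
def chi (A : Fin N → Option {a // a ∈ σ}) (j : ι) (U : (Fr j).W → Fin N → Prop)
    (w : (Fr j).W) : MForm ℕ :=
  substAtoms (subA A) (τ ⟨j, w, U⟩)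

/-- Separation condition. -/
noncomputable def sepF (A : Fin N → Option {a // a ∈ σ}) (j : ι)
    (U : (Fr j).W → Fin N → Prop) : MForm ℕ :=
  bigAnd ((Finset.univ : Finset ((Fr j).W × {a // a ∈ σ})).toList.map (fun x =>
    (dle n (.and (chi Fr τ A j U x.1) (.atom x.2.1))).imp
      (ble n ((chi Fr τ A j U x.1).imp (.atom x.2.1)))))

open Classical in
noncomputable def decF (A : Fin N → Option {a // a ∈ σ}) (j : ι)
    (U : (Fr j).W → Fin N → Prop) (k : ℕ) : MForm ℕ :=
  if h : ∃ w, wcode (Fr j) w = k.unpair.1 then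
    dle n (.and (chi Fr τ A j U h.choose) (.atom k.unpair.2))
  else .top

theorem decF_pair (A : Fin N → Option {a // a ∈ σ}) (j : ι)
    (U : (Fr j).W → Fin N → Prop) (w : (Fr j).W) (a : ℕ) :
    decF Fr τ n A j U (Nat.pair (wcode (Fr j) w) a) =
      dle n (.and (chi Fr τ A j U w) (.atom a)) := by
  have h : ∃ w', wcode (Fr j) w' = (Nat.pair (wcode (Fr j) w) a).unpair.1 := ⟨w, by simp⟩
  have h2 : h.choose = w := by
    have h3 : (Nat.pair (wcode (Fr j) w) a).unpair.1 = wcode (Fr j) w := by simp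
    exact wcode_inj _ (h.choose_spec.trans h3)
  unfold decF
  rw [dif_pos h, h2, Nat.unpair_pair]

noncomputable def disjF (ξ : ι → MForm ℕ) (A : Fin N → Option {a // a ∈ σ}) (j : ι)
    (U : (Fr j).W → Fin N → Prop) : MForm ℕ :=
  .and (chi Fr τ A j U (Fr j).pt)
    (.and (sepF Fr τ n A j U) (substAtoms (decF Fr τ n A j U) (ξ j)))

theorem sig_chi (A : Fin N → Option {a // a ∈ σ}) (j : ι) (U : (Fr j).W → Fin N → Prop)
    (w : (Fr j).W) : (chi Fr τ A j U w).sig ⊆ σ :=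
  sig_subst _ _ _ (fun k _ => sig_subA A k)

theorem sig_disjF (ξ : ι → MForm ℕ) (hξ : ∀ j, ∀ k ∈ (ξ j).sig, k.unpair.2 ∈ σ)
    (A : Fin N → Option {a // a ∈ σ}) (j : ι) (U : (Fr j).W → Fin N → Prop) :
    (disjF Fr τ n ξ A j U).sig ⊆ σ := by
  refine Finset.union_subset (sig_chi Fr τ A j U _) (Finset.union_subset ?_ ?_)
  · refine sig_bigAnd _ _ ?_
    intro φ hφ
    obtain ⟨x, _, rfl⟩ := List.mem_map.1 hφ
    have h1 : (MForm.atom x.2.1).sig ⊆ σ := by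
      simp [MForm.sig, x.2.2]
    refine Finset.union_subset ?_ ?_
    · exact sig_dle n σ _ (Finset.union_subset (sig_chi Fr τ A j U _) h1)
    · exact sig_ble n σ _ (Finset.union_subset (sig_chi Fr τ A j U _) h1)
  · refine sig_subst _ _ _ ?_
    intro k hk
    unfold decF
    split
    · refine sig_dle n σ _ (Finset.union_subset (sig_chi Fr τ A j U _) ?_)
      simp [MForm.sig, hξ j k hk]
    · simp [MForm.sig]

theorem ds_disjF (T M m s : ℕ) (hT : ∀ x, (τ x).dagSize ≤ T)
    (hM : ∀ j, Fintype.card (Fr j).W ≤ M) (ξ : ι → MForm ℕ) (hξ : ∀ j, (ξ j).dagSize ≤ m)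
    (hs : σ.card ≤ s)
    (A : Fin N → Option {a // a ∈ σ}) (j : ι) (U : (Fr j).W → Fin N → Prop) :
    (disjF Fr τ n ξ A j U).dagSize ≤
      3 * T + M * s * (2 * ((n + 1) * (3 * T + 5 + n + 1)) + 7) +
        m * ((n + 1) * (3 * T + 5 + n + 1) + 3) + 3 := by
  set B := (n + 1) * (3 * T + 5 + n + 1) with hB
  have hchi : ∀ w, (chi Fr τ A j U w).dagSize ≤ 3 * T := by
    intro w
    have h1 := ds_subst (subA A) 2 (ds_subA A) (τ ⟨j, w, U⟩)
    have h2 := hT ⟨j, w, U⟩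
    unfold chi
    omega
  have hd : ∀ w a, (dle n (.and (chi Fr τ A j U w) (.atom a))).dagSize ≤ B + 2 := by
    intro w a
    refine ds_dle n (3 * T + 5) _ ?_
    have h1 := ds_and (chi Fr τ A j U w) (.atom a)
    have h2 := hchi w
    rw [ds_atom] at h1
    omega
  have hb : ∀ w a, (ble n ((chi Fr τ A j U w).imp (.atom a))).dagSize ≤ B + 1 := by
    intro w a
    refine ds_ble n (3 * T + 5) _ ?_
    have h1 := ds_imp (chi Fr τ A j U w) (.atom a)
    have h2 := hchi w
    rw [ds_atom] at h1
    omega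
  have hsep : (sepF Fr τ n A j U).dagSize ≤ M * s * (2 * B + 7) + 1 := by
    have h1 := ds_bigAnd (2 * B + 6)
      ((Finset.univ : Finset ((Fr j).W × {a // a ∈ σ})).toList.map (fun x =>
        (dle n (.and (chi Fr τ A j U x.1) (.atom x.2.1))).imp
          (ble n ((chi Fr τ A j U x.1).imp (.atom x.2.1))))) (by
      intro φ hφ
      obtain ⟨x, _, rfl⟩ := List.mem_map.1 hφ
      refine (ds_imp _ _).trans ?_
      have h2 := hd x.1 x.2.1
      have h3 := hb x.1 x.2.1
      omega)
    refine h1.trans (Nat.add_le_add_right (Nat.mul_le_mul_right _ ?_) _)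
    rw [List.length_map, Finset.length_toList, Finset.card_univ, Fintype.card_prod]
    refine Nat.mul_le_mul (hM j) ?_
    rw [Fintype.card_coe]
    exact hs
  have hx : (substAtoms (decF Fr τ n A j U) (ξ j)).dagSize ≤ m * (B + 3) := by
    refine (ds_subst _ (B + 2) ?_ _).trans ?_
    · intro k
      unfold decF
      split
      · exact hd _ _
      · rw [ds_top]; omega
    · calc (ξ j).dagSize + (ξ j).dagSize * (B + 2) = (ξ j).dagSize * (B + 3) := by ring
        _ ≤ m * (B + 3) := Nat.mul_le_mul_right _ (hξ j)
  have h1 := ds_and (chi Fr τ A j U (Fr j).pt)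
    (.and (sepF Fr τ n A j U) (substAtoms (decF Fr τ n A j U) (ξ j)))
  have h2 := ds_and (sepF Fr τ n A j U) (substAtoms (decF Fr τ n A j U) (ξ j))
  have h3 := hchi (Fr j).pt
  unfold disjF
  omega

variable (hτ : ∀ x y : Univ Fr N, holds y (τ x) ↔ ∀ θ, (holds x θ ↔ holds y θ))
  (hn : ∀ i, Bound (Fr i) n)

theorem sat_chi (hτ : ∀ x y : Univ Fr N, holds y (τ x) ↔ ∀ θ, (holds x θ ↔ holds y θ))
    (A : Fin N → Option {a // a ∈ σ}) (j : ι) (U : (Fr j).W → Fin N → Prop)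
    (w : (Fr j).W) (i : ι) (V : (Fr i).W → ℕ → Prop) (u : (Fr i).W) :
    sat (Fr i) V u (chi Fr τ A j U w) ↔
      ∀ θ, (sat (Fr j) (extV U) w θ ↔ sat (Fr i) (extV (valA V A)) u θ) := by
  unfold chi
  rw [sat_subA]
  exact hτ ⟨j, w, U⟩ ⟨i, u, valA V A⟩

theorem sat_sepF (hn : ∀ i, Bound (Fr i) n)
    (A : Fin N → Option {a // a ∈ σ}) (j : ι) (U : (Fr j).W → Fin N → Prop)
    (i : ι) (V : (Fr i).W → ℕ → Prop) :
    sat (Fr i) V (Fr i).pt (sepF Fr τ n A j U) ↔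
      ∀ w, ∀ a ∈ σ, (∃ u, Reach (Fr i) u ∧ sat (Fr i) V u (chi Fr τ A j U w) ∧ V u a) →
        ∀ u, Reach (Fr i) u → sat (Fr i) V u (chi Fr τ A j U w) → V u a := by
  unfold sepF
  rw [sat_bigAnd]
  constructor
  · intro h w a ha
    have := h _ (List.mem_map.2 ⟨(w, ⟨a, ha⟩), by simp, rfl⟩)
    rw [sat_imp, sat_dle _ (hn i), sat_ble _ (hn i)] at this
    simpa only [sat_imp, sat] using this
  · intro h φ hφ
    obtain ⟨x, _, rfl⟩ := List.mem_map.1 hφ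
    rw [sat_imp, sat_dle _ (hn i), sat_ble _ (hn i)]
    simpa only [sat_imp, sat] using h x.1 x.2.1 x.2.2

/-- Soundness: a model of a disjunct is equivalent over `σ` to a model of `φ`. -/
theorem disj_sound
    (hτ : ∀ x y : Univ Fr N, holds y (τ x) ↔ ∀ θ, (holds x θ ↔ holds y θ))
    (hn : ∀ i, Bound (Fr i) n) (φ : MForm ℕ) (ξ : ι → MForm ℕ) (hξp : ∀ j, (ξ j).IsProp)
    (hξ : ∀ j v, psat v (ξ j) ↔ ∃ v' : ℕ → Prop,
      (∀ k : ℕ, k.unpair.2 ∈ σ → (v' k ↔ v k)) ∧ psat v' (ptr (Fr j) φ (Fr j).pt))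
    (A : Fin N → Option {a // a ∈ σ}) (j : ι) (U : (Fr j).W → Fin N → Prop)
    (i : ι) (V : (Fr i).W → ℕ → Prop)
    (h : sat (Fr i) V (Fr i).pt (disjF Fr τ n ξ A j U)) :
    ∃ V' : (Fr j).W → ℕ → Prop, sat (Fr j) V' (Fr j).pt φ ∧
      ∀ ψ : MForm ℕ, ψ.sig ⊆ σ → (sat (Fr i) V (Fr i).pt ψ ↔ sat (Fr j) V' (Fr j).pt ψ) := by
  obtain ⟨h1, h2, h3⟩ := h
  rw [sat_subst_prop _ _ _ _ _ (hξp j), hξ] at h3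
  obtain ⟨v', hag, hv'⟩ := h3
  rw [psat_trans] at hv'
  rw [sat_sepF Fr τ n hn] at h2
  refine ⟨_, hv', ?_⟩
  have hV : ∀ w, ∀ a ∈ σ, (v' (Nat.pair (wcode (Fr j) w) a) ↔
      ∃ u, Reach (Fr i) u ∧ sat (Fr i) V u (chi Fr τ A j U w) ∧ V u a) := by
    intro w a ha
    rw [hag _ (by simpa using ha), decF_pair, sat_dle _ (hn i)]
    simp only [sat]
  have key : ∀ ψ : MForm ℕ, ψ.sig ⊆ σ → ∀ u w, Reach (Fr i) u →
      sat (Fr i) V u (chi Fr τ A j U w) →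
      (sat (Fr i) V u ψ ↔ sat (Fr j) (fun w a => v' (Nat.pair (wcode (Fr j) w) a)) w ψ) := by
    intro ψ
    induction ψ with
    | top => intros; rfl
    | atom a =>
      intro hs u w hu huw
      have ha : a ∈ σ := hs (by simp [MForm.sig])
      simp only [sat]
      rw [hV w a ha]
      exact ⟨fun h => ⟨u, hu, huw, h⟩, fun h => h2 w a ha h u hu huw⟩
    | neg ψ ih => intro hs u w hu huw; exact not_congr (ih hs u w hu huw)
    | and ψ₁ ψ₂ ih1 ih2 =>
      intro hs u w hu huw
      exact and_congr (ih1 (Finset.union_subset_left hs) u w hu huw)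
        (ih2 (Finset.union_subset_right hs) u w hu huw)
    | box ψ ih =>
      intro hs u w hu huw
      rw [sat_chi Fr τ hτ] at huw
      constructor
      · intro hbox w' hw'
        have hx := huw (MForm.dia (τ ⟨j, w', U⟩))
        have hl : sat (Fr j) (extV U) w (MForm.dia (τ ⟨j, w', U⟩)) := by
          intro hall
          exact hall w' hw' ((hτ ⟨j, w', U⟩ ⟨j, w', U⟩).2 (fun _ => Iff.rfl))
        have hr := hx.1 hl
        simp only [MForm.dia, sat, not_forall, not_not] at hr
        obtain ⟨u', hu', hsat⟩ := hr
        have hsat' : sat (Fr i) V u' (chi Fr τ A j U w') := (sat_subA _ _ _ _ _).2 hsat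
        exact (ih hs u' w' (reach_step _ hu hu') hsat').1 (hbox u' hu')
      · intro hbox u' hu'
        have hx := huw (MForm.dia (τ ⟨i, u', valA V A⟩))
        have hr : sat (Fr i) (extV (valA V A)) u (MForm.dia (τ ⟨i, u', valA V A⟩)) := by
          intro hall
          exact hall u' hu' ((hτ ⟨i, u', valA V A⟩ ⟨i, u', valA V A⟩).2 (fun _ => Iff.rfl))
        have hl := hx.2 hr
        simp only [MForm.dia, sat, not_forall, not_not] at hl
        obtain ⟨w', hw', hsat⟩ := hl
        have hsat' : sat (Fr i) V u' (chi Fr τ A j U w') := by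
          rw [sat_chi Fr τ hτ]
          intro θ
          exact ((hτ ⟨i, u', valA V A⟩ ⟨j, w', U⟩).1 hsat θ).symm
        exact (ih hs u' w' (reach_step _ hu hu') hsat').2 (hbox w' hw')
  intro ψ hψ
  exact key ψ hψ _ _ (reach_pt _) h1

/-- Completeness: every model of `φ` satisfies some disjunct. -/
theorem disj_complete
    (hτ : ∀ x y : Univ Fr N, holds y (τ x) ↔ ∀ θ, (holds x θ ↔ holds y θ))
    (hn : ∀ i, Bound (Fr i) n) (e : (Σ i, (Fr i).W × (Fr i).W) ≃ Fin N)
    (φ : MForm ℕ) (ξ : ι → MForm ℕ) (hξp : ∀ j, (ξ j).IsProp)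
    (hξ : ∀ j v, psat v (ξ j) ↔ ∃ v' : ℕ → Prop,
      (∀ k : ℕ, k.unpair.2 ∈ σ → (v' k ↔ v k)) ∧ psat v' (ptr (Fr j) φ (Fr j).pt))
    (j : ι) (V : (Fr j).W → ℕ → Prop) (h : sat (Fr j) V (Fr j).pt φ) :
    ∃ (A : Fin N → Option {a // a ∈ σ}) (U : (Fr j).W → Fin N → Prop),
      sat (Fr j) V (Fr j).pt (disjF Fr τ n ξ A j U) := by
  classical
  have hA : ∀ x : (Σ i, (Fr i).W × (Fr i).W), ∃ o : Option {a // a ∈ σ}, ∀ w w', x = ⟨j, w, w'⟩ →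
      (∃ a ∈ σ, ¬ (V w a ↔ V w' a)) → ∃ a, o = some a ∧ ¬ (V w a.1 ↔ V w' a.1) := by
    intro x
    by_cases hx : ∃ w w', x = ⟨j, w, w'⟩ ∧ ∃ a ∈ σ, ¬ (V w a ↔ V w' a)
    · obtain ⟨w, w', rfl, a, ha, hne⟩ := hx
      refine ⟨some ⟨a, ha⟩, ?_⟩
      intro w1 w1' heq _
      simp only [Sigma.mk.injEq, heq_eq_eq, Prod.mk.injEq, true_and] at heq
      obtain ⟨rfl, rfl⟩ := heq
      exact ⟨_, rfl, hne⟩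
    · exact ⟨none, fun w w' h1 h2 => absurd ⟨w, w', h1, h2⟩ hx⟩
  choose A0 hA0 using hA
  set A : Fin N → Option {a // a ∈ σ} := fun k => A0 (e.symm k) with hAdef
  set U := valA V A with hU
  have hsep : ∀ w w', (∀ θ, (sat (Fr j) (extV U) w θ ↔ sat (Fr j) (extV U) w' θ)) →
      ∀ a ∈ σ, (V w a ↔ V w' a) := by
    intro w w' heq a ha
    by_contra hne
    obtain ⟨b, hb, hbne⟩ := hA0 ⟨j, w, w'⟩ w w' rfl ⟨a, ha, hne⟩
    have hk : A (e ⟨j, w, w'⟩) = some b := by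
      simp only [hAdef, Equiv.symm_apply_apply]
      exact hb
    have hval : ∀ u, extV U u (e ⟨j, w, w'⟩).val ↔ V u b.1 := by
      intro u
      simp only [extV, Fin.is_lt, Fin.eta, exists_true_left, hU, valA, hk]
    have := heq (MForm.atom (e ⟨j, w, w'⟩).val)
    simp only [sat] at this
    rw [hval, hval] at this
    exact hbne this
  have hself : ∀ w, sat (Fr j) V w (chi Fr τ A j U w) := by
    intro w
    rw [sat_chi Fr τ hτ]
    exact fun _ => Iff.rfl
  have hdec : ∀ w, Reach (Fr j) w → ∀ a ∈ σ,
      (sat (Fr j) V (Fr j).pt (decF Fr τ n A j U (Nat.pair (wcode (Fr j) w) a)) ↔ V w a) := by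
    intro w hw a ha
    rw [decF_pair, sat_dle _ (hn j)]
    constructor
    · rintro ⟨u, hu, hchi, hua⟩
      rw [sat_chi Fr τ hτ] at hchi
      exact (hsep w u hchi a ha).2 hua
    · intro hwa
      exact ⟨w, hw, hself w, hwa⟩
  refine ⟨A, U, hself _, ?_, ?_⟩
  · rw [sat_sepF Fr τ n hn]
    rintro w a ha ⟨u, hu, hchi, hua⟩ u' hu' hchi'
    rw [sat_chi Fr τ hτ] at hchi hchi'
    exact (hsep w u' hchi' a ha).1 ((hsep w u hchi a ha).2 hua)
  · rw [sat_subst_prop _ _ _ _ _ (hξp j), hξ]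
    refine ⟨fun k => if k.unpair.2 ∈ σ then sat (Fr j) V (Fr j).pt (decF Fr τ n A j U k)
      else ∃ w, wcode (Fr j) w = k.unpair.1 ∧ V w k.unpair.2, ?_, ?_⟩
    · intro k hk
      simp only [hk, if_true]
    · rw [psat_trans]
      refine (sat_local (Fr j) V _ ?_ φ _ (reach_pt _)).1 h
      intro w hw a
      by_cases ha : a ∈ σ
      · simp only [Nat.unpair_pair, ha, if_true]
        exact (hdec w hw a ha).symm
      · simp only [Nat.unpair_pair, ha, if_false]
        constructor
        · intro hwa
          exact ⟨w, rfl, hwa⟩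
        · rintro ⟨w', hw', hwa⟩
          exact wcode_inj _ hw' ▸ hwa

end Main

/-- for a tabular quasi-normal modal logic `L` there are polynomials `p`, `q`
(depending only on `L`) such that for every monotone `f : ℕ → ℕ`: if every propositional
formula `χ` has, for every signature `σ' ⊆ sig χ`, a uniform `σ'`-interpolant of dag-size
at most `f(|χ|)`, then every modal formula `φ` and every `σ ⊆ sig φ` admit a strongest
`L(σ)`-implicate of dag-size at most `p(f(q(|φ|)))`. -/
theorem stmt11 (L : Set (MForm ℕ)) (hL : Tabular L) :
    ∃ p q : Polynomial ℕ, ∀ f : ℕ → ℕ, Monotone f →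
      (∀ χ : MForm ℕ, χ.IsProp → ∀ σ' ⊆ χ.sig,
        ∃ ξ : MForm ℕ, UPropInt σ' χ ξ ∧ ξ.dagSize ≤ f χ.dagSize) →
      ∀ φ : MForm ℕ, ∀ σ ⊆ φ.sig,
        ∃ χ : MForm ℕ, StrImp L σ φ χ ∧ χ.dagSize ≤ p.eval (f (q.eval φ.dagSize)) := by
  classical
  obtain ⟨ι, hι, Fr, rfl⟩ := hL
  -- constants depending only on the logic
  set N := Fintype.card (Σ i, (Fr i).W × (Fr i).W) with hN
  have e : (Σ i, (Fr i).W × (Fr i).W) ≃ Fin N := Fintype.equivFin _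
  obtain ⟨τ, hτ⟩ := exists_char Fr N
  have hfinU : Fintype (Univ Fr N) := Fintype.ofFinite _
  have hfinJ : Fintype (Σ j, ((Fr j).W → Fin N → Prop)) := Fintype.ofFinite _
  choose nb hnb using fun i => exists_bound (Fr i)
  set n := Finset.univ.sup nb with hndef
  have hn : ∀ i, Bound (Fr i) n := fun i =>
    bound_mono _ (Finset.le_sup (f := nb) (Finset.mem_univ i)) (hnb i)
  set T := Finset.univ.sup (fun x : Univ Fr N => (τ x).dagSize) with hTdef
  have hT : ∀ x, (τ x).dagSize ≤ T := fun x =>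
    Finset.le_sup (f := fun x : Univ Fr N => (τ x).dagSize) (Finset.mem_univ x)
  set M := Finset.univ.sup (fun i => Fintype.card (Fr i).W) with hMdef
  have hM : ∀ i, Fintype.card (Fr i).W ≤ M := fun i =>
    Finset.le_sup (f := fun i => Fintype.card (Fr i).W) (Finset.mem_univ i)
  set K := Fintype.card (Σ j, ((Fr j).W → Fin N → Prop)) with hK
  set B := (n + 1) * (3 * T + 5 + n + 1) with hB
  set c := 3 * T + M * (2 * B + 7) + (B + 3) + 3 with hc
  refine ⟨Polynomial.C (K * (c + 2) + 2) * (Polynomial.X + 1) ^ (N + 1),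
    Polynomial.C (M * (M + 1)) * Polynomial.X + (2 * Polynomial.X + 1), ?_⟩
  intro f hf hitp φ σ hσ
  simp only [Polynomial.eval_mul, Polynomial.eval_C, Polynomial.eval_pow, Polynomial.eval_add,
    Polynomial.eval_X, Polynomial.eval_one, Polynomial.eval_ofNat]
  set G := f (M * (M + 1) * φ.dagSize + (2 * φ.dagSize + 1)) with hG
  have hsG : σ.card ≤ G := by
    refine (f_lower f hf hitp σ).trans (hf ?_)
    have h1 := (Finset.card_le_card hσ).trans (card_sig_le φ)
    have h2 : 0 ≤ M * (M + 1) * φ.dagSize := Nat.zero_le _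
    omega
  choose ξ hξ hξsz using fun j => hitp (ptr (Fr j) φ (Fr j).pt) (isProp_trans _ _ _)
    ((ptr (Fr j) φ (Fr j).pt).sig.filter (fun k : ℕ => k.unpair.2 ∈ σ)) (Finset.filter_subset _ _)
  have hξG : ∀ j, (ξ j).dagSize ≤ G := by
    intro j
    refine (hξsz j).trans (hf ((ds_trans (Fr j) φ (Fr j).pt).trans ?_))
    have h1 : Fintype.card (Fr j).W * (Fintype.card (Fr j).W + 1) ≤ M * (M + 1) :=
      Nat.mul_le_mul (hM j) (Nat.add_le_add_right (hM j) 1)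
    have h2 := Nat.mul_le_mul_left φ.dagSize h1
    rw [Nat.mul_comm φ.dagSize (M * (M + 1))] at h2
    omega
  have hξp : ∀ j, (ξ j).IsProp := fun j => (hξ j).1
  have hξi : ∀ j v, psat v (ξ j) ↔ ∃ v' : ℕ → Prop,
      (∀ k : ℕ, k.unpair.2 ∈ σ → (v' k ↔ v k)) ∧ psat v' (ptr (Fr j) φ (Fr j).pt) := by
    intro j v
    refine interp_iff (fun k : ℕ => k.unpair.2 ∈ σ) _ (ξ j) ?_ v
    convert hξ j
  have hξs : ∀ j, ∀ k ∈ (ξ j).sig, k.unpair.2 ∈ σ := by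
    intro j k hk
    exact (Finset.mem_filter.1 ((hξ j).2.1 hk)).2
  let D : (Fin N → Option {a // a ∈ σ}) × (Σ j, ((Fr j).W → Fin N → Prop)) → MForm ℕ :=
    fun x => disjF Fr τ n ξ x.1 x.2.1 x.2.2
  refine ⟨bigOr (Finset.univ.toList.map D), ⟨?_, ?_, ?_⟩, ?_⟩
  · refine sig_bigOr _ _ ?_
    intro ψ hψ
    obtain ⟨x, _, rfl⟩ := List.mem_map.1 hψ
    exact sig_disjF Fr τ n ξ hξs _ _ _
  · intro j V
    rw [sat_imp, sat_bigOr]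
    intro h
    obtain ⟨A, U, hAU⟩ := disj_complete Fr τ n hτ hn e φ ξ hξp hξi j V h
    exact ⟨_, List.mem_map.2 ⟨(A, ⟨j, U⟩), by simp, rfl⟩, hAU⟩
  · intro ψ hψ hφψ i V
    rw [sat_imp, sat_bigOr]
    rintro ⟨_, hmem, hsat⟩
    obtain ⟨x, _, rfl⟩ := List.mem_map.1 hmem
    obtain ⟨V', h1, h2⟩ := disj_sound Fr τ n hτ hn φ ξ hξp hξi _ _ _ i V hsat
    have h3 := hφψ x.2.1 V'
    rw [sat_imp] at h3
    exact (h2 ψ hψ).2 (h3 h1)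
  · have hone : ∀ ψ ∈ Finset.univ.toList.map D, ψ.dagSize ≤ c * (G + 1) := by
      intro ψ hψ
      obtain ⟨x, _, rfl⟩ := List.mem_map.1 hψ
      refine (ds_disjF Fr τ n T M G G hT hM ξ hξG hsG _ _ _).trans ?_
      rw [← hB, hc]
      nlinarith [Nat.zero_le (T * G), Nat.zero_le (M * (2 * B + 7)), Nat.zero_le G,
        Nat.zero_le B]
    refine (ds_bigOr _ _ hone).trans ?_
    have hlen : (Finset.univ.toList.map D).length ≤ (G + 1) ^ N * K := by
      rw [List.length_map, Finset.length_toList, Finset.card_univ, Fintype.card_prod]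
      refine Nat.mul_le_mul ?_ (le_of_eq (by rw [hK]))
      rw [Fintype.card_fun, Fintype.card_option, Fintype.card_coe, Fintype.card_fin]
      exact Nat.pow_le_pow_left (Nat.add_le_add_right hsG 1) N
    have hP : 1 ≤ (G + 1) ^ (N + 1) := Nat.one_le_pow _ _ (Nat.succ_pos _)
    calc (Finset.univ.toList.map D).length * (c * (G + 1) + 2) + 2
        ≤ ((G + 1) ^ N * K) * ((c + 2) * (G + 1)) + 2 * (G + 1) ^ (N + 1) := by
          refine Nat.add_le_add (Nat.mul_le_mul hlen ?_) (by omega)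
          nlinarith [Nat.zero_le G]
      _ = (K * (c + 2) + 2) * (G + 1) ^ (N + 1) := by ring
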